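/- arXiv:2411.05487 — 5 statements merged into one kernel-verified Lean document; each statement's English description precedes it below -/
import Mathlib

section
/- Let n₁ ≥ 2 be an integer, let 0 < a < n₁, and let U₁ and V₁ be independent random variables, where U₁ has the exponential distribution of rate n₁ and V₁ has the Gamma distribution of shape n₁-1 and scale 1. Then for c > 0, E[a(e^{a(U₁ - cV₁)} - 1)V₁] = 0 if and only if c = (1/a)((n₁/(n₁-a))^{1/n₁} - 1). -/
open MeasureTheory ProbabilityTheory Real

lemma gamma_aux (k r s : ℝ) (hk : 0 < k) (hr : 0 < r) (hs : s < r) (m : ℕ) :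
    ∫ x, x ^ m * Real.exp (s * x) ∂(gammaMeasure k r) =
      r ^ k / Gamma k * ((1 / (r - s)) ^ (k + m) * Gamma (k + m)) := by
  have hmeas : Measurable (gammaPDF k r) := (measurable_gammaPDFReal k r).ennreal_ofReal
  rw [gammaMeasure, integral_withDensity_eq_integral_toReal_smul hmeas
    (by filter_upwards with x using by simp [gammaPDF])]
  have h1 : (fun x : ℝ => (gammaPDF k r x).toReal • (x ^ m * Real.exp (s * x))) =
      Set.indicator (Set.Ici 0) (fun x : ℝ => r ^ k / Gamma k * x ^ (k - 1) * exp (-(r * x)) *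
        (x ^ m * Real.exp (s * x))) := by
    funext x
    rw [gammaPDF, ENNReal.toReal_ofReal (gammaPDFReal_nonneg hk hr x)]
    by_cases hx : 0 ≤ x
    · simp [gammaPDFReal, hx]
    · simp [gammaPDFReal, hx]
  rw [h1, integral_indicator measurableSet_Ici, integral_Ici_eq_integral_Ioi]
  have h2 : ∀ x ∈ Set.Ioi (0:ℝ), r ^ k / Gamma k * x ^ (k - 1) * exp (-(r * x)) *
        (x ^ m * Real.exp (s * x)) =
        r ^ k / Gamma k * (x ^ (k + m - 1) * exp (-((r - s) * x))) := by
    intro x hx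
    have hx' : (0:ℝ) < x := hx
    rw [show k + m - 1 = (k - 1) + (m : ℝ) by ring, rpow_add hx', rpow_natCast,
      show -((r - s) * x) = -(r * x) + s * x by ring, Real.exp_add]
    ring
  rw [setIntegral_congr_fun measurableSet_Ioi h2, integral_const_mul,
    integral_rpow_mul_exp_neg_mul_Ioi (by positivity) (by linarith)]

lemma gamma_aux_integrable (k r s : ℝ) (hk : 0 < k) (hr : 0 < r) (hs : s < r) (m : ℕ) :
    Integrable (fun x : ℝ => x ^ m * Real.exp (s * x)) (gammaMeasure k r) := by
  by_contra h
  have h1 := integral_undef h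
  rw [gamma_aux k r s hk hr hs m] at h1
  have : 0 < r - s := by linarith
  have h3 : 0 < Gamma k := Gamma_pos_of_pos hk
  have h4 : 0 < Gamma (k + m) := Gamma_pos_of_pos (by positivity)
  have : 0 < r ^ k / Gamma k * ((1 / (r - s)) ^ (k + m) * Gamma (k + m)) := by positivity
  linarith

/-- For `U₁ ~ Exp(rate n₁)` and `V₁ ~ Gamma(n₁ - 1, 1)` independent and
`0 < a < n₁`, for `c > 0` one has `E[a(e^{a(U₁ - c V₁)} - 1) V₁] = 0` iff
`c = (1/a)((n₁/(n₁-a))^{1/n₁} - 1)`. -/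
theorem stmt_1 (n₁ : ℕ) (hn₁ : 2 ≤ n₁) (a : ℝ) (ha : 0 < a) (ha' : a < n₁)
    (ν : Measure (ℝ × ℝ))
    (hν : ν = (expMeasure n₁).prod (gammaMeasure ((n₁ : ℝ) - 1) 1)) :
    ∀ c : ℝ, 0 < c →
      ((∫ p : ℝ × ℝ, a * (Real.exp (a * (p.1 - c * p.2)) - 1) * p.2 ∂ν) = 0 ↔
        c = (1 / a) * (((n₁ : ℝ) / ((n₁ : ℝ) - a)) ^ ((1 : ℝ) / (n₁ : ℝ)) - 1)) := by
  intro c hc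
  subst hν
  have hn : (2:ℝ) ≤ n₁ := by exact_mod_cast hn₁
  have hn0 : (0:ℝ) < n₁ := by linarith
  have hk : (0:ℝ) < (n₁:ℝ) - 1 := by linarith
  have hac : 0 < a * c := mul_pos ha hc
  have hna : 0 < (n₁:ℝ) - a := by linarith
  haveI := isProbabilityMeasure_gammaMeasure zero_lt_one hn0
  haveI := isProbabilityMeasure_gammaMeasure hk zero_lt_one
  have hG : Gamma ((n₁:ℝ) - 1 + 1) = ((n₁:ℝ) - 1) * Gamma ((n₁:ℝ) - 1) := Gamma_add_one hk.ne'
  have hG0 : 0 < Gamma ((n₁:ℝ) - 1) := Gamma_pos_of_pos hk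
  have iU := gamma_aux_integrable 1 n₁ a one_pos hn0 ha' 0
  have iU0 := gamma_aux_integrable 1 n₁ 0 one_pos hn0 hn0 0
  have iV := gamma_aux_integrable _ 1 (-(a * c)) hk one_pos (by linarith) 1
  have iV0 := gamma_aux_integrable _ 1 0 hk one_pos one_pos 1
  have eU := gamma_aux 1 n₁ a one_pos hn0 ha' 0
  have eU0 := gamma_aux 1 n₁ 0 one_pos hn0 hn0 0
  have eV := gamma_aux _ 1 (-(a * c)) hk one_pos (by linarith) 1
  have eV0 := gamma_aux _ 1 0 hk one_pos one_pos 1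
  have key : (∫ p : ℝ × ℝ, a * (Real.exp (a * (p.1 - c * p.2)) - 1) * p.2
      ∂((expMeasure n₁).prod (gammaMeasure ((n₁ : ℝ) - 1) 1))) =
      a * ((n₁:ℝ) - 1) * ((n₁ / (n₁ - a)) * (1 / (1 + a * c)) ^ n₁ - 1) := by
    rw [expMeasure]
    have : (fun p : ℝ × ℝ => a * (Real.exp (a * (p.1 - c * p.2)) - 1) * p.2) =
        fun p : ℝ × ℝ =>
          a * ((p.1 ^ 0 * rexp (a * p.1)) * (p.2 ^ 1 * rexp (-(a * c) * p.2)) -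
            (p.1 ^ 0 * rexp (0 * p.1)) * (p.2 ^ 1 * rexp (0 * p.2))) := by
      funext p
      rw [show a * (p.1 - c * p.2) = a * p.1 + -(a * c) * p.2 by ring, Real.exp_add]
      simp
      ring
    rw [this, integral_const_mul, integral_sub (iU.mul_prod iV) (iU0.mul_prod iV0),
      integral_prod_mul (fun x : ℝ => x ^ 0 * rexp (a * x))
        (fun x : ℝ => x ^ 1 * rexp (-(a * c) * x)),
      integral_prod_mul (fun x : ℝ => x ^ 0 * rexp (0 * x)) (fun x : ℝ => x ^ 1 * rexp (0 * x)),
      eU, eU0, eV, eV0]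
    have e1 : ((n₁:ℝ) - 1 + ((1:ℕ):ℝ)) = n₁ := by push_cast; ring
    have e2 : Gamma (n₁:ℝ) = ((n₁:ℝ) - 1) * Gamma ((n₁:ℝ) - 1) := by rw [← hG]; congr 1; ring
    rw [e1, rpow_natCast, rpow_natCast, e2]
    simp only [Nat.cast_zero, add_zero, rpow_one, one_rpow, Gamma_one, sub_neg_eq_add, sub_zero,
      div_one, one_pow, mul_one]
    field_simp
  rw [key]
  have hb : 0 < 1 + a * c := by linarith
  have hq : 0 < (n₁:ℝ) / (n₁ - a) := by positivity
  have hne : n₁ ≠ 0 := by omega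
  have s1 : a * ((n₁:ℝ) - 1) * ((n₁ / (n₁ - a)) * (1 / (1 + a * c)) ^ n₁ - 1) = 0 ↔
      (1 + a * c) ^ n₁ = (n₁:ℝ) / (n₁ - a) := by
    rw [mul_eq_zero, or_iff_right (by positivity), sub_eq_zero, one_div, inv_pow,
      mul_inv_eq_one₀ (by positivity), eq_comm]
  rw [s1]
  have s2 : (c = (1 / a) * (((n₁ : ℝ) / ((n₁ : ℝ) - a)) ^ ((1 : ℝ) / (n₁ : ℝ)) - 1)) ↔
      1 + a * c = ((n₁ : ℝ) / ((n₁ : ℝ) - a)) ^ ((1 : ℝ) / (n₁ : ℝ)) := by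
    generalize ((n₁ : ℝ) / ((n₁ : ℝ) - a)) ^ ((1 : ℝ) / (n₁ : ℝ)) = t
    constructor
    · intro h; rw [h]; field_simp; ring
    · intro h; rw [← h]; field_simp; ring
  rw [s2, one_div]
  constructor
  · intro h
    rw [← h, pow_rpow_inv_natCast hb.le hne]
  · intro h
    rw [h, rpow_inv_natCast_pow hq.le hne]
end

section
/- Let n₁ ≥ 2 be an integer and let U₁ and V₁ be independent random variables, where U₁ has the exponential distribution of rate n₁ and V₁ has the Gamma distribution of shape n₁-1 and scale 1. Then there exists a unique real number c₀₁ such that E[L′(U₁ - c₀₁V₁)V₁] = 0; moreover c₀₁ > 0 and E[L(U₁ - c₀₁V₁)] ≤ E[L(U₁ - cV₁)] for every c ∈ ℝ. -/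
open MeasureTheory ProbabilityTheory Real

lemma aux_int_pos {α : Type*} [MeasurableSpace α] (μ : Measure α) [IsProbabilityMeasure μ]
    (f : α → ℝ) (hf : Integrable f μ) (hpos : ∀ᵐ x ∂μ, 0 < f x) : 0 < ∫ x, f x ∂μ := by
  have hnn : 0 ≤ᵐ[μ] f := by
    filter_upwards [hpos] with x hx using hx.le
  refine lt_of_le_of_ne (integral_nonneg_of_ae hnn) ?_
  intro h
  have h0 := (integral_eq_zero_iff_of_nonneg_ae hnn hf).1 h.symm
  have : ∀ᵐ x ∂μ, False := by
    filter_upwards [hpos, h0] with x hx hx0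
    simp only [Pi.zero_apply] at hx0
    linarith
  obtain ⟨x, hx⟩ := this.exists
  exact hx

lemma aux_gamma_pos (a r : ℝ) : ∀ᵐ x ∂(gammaMeasure a r), 0 < x := by
  have hm : Measurable (gammaPDF a r) := (measurable_gammaPDFReal a r).ennreal_ofReal
  rw [gammaMeasure, ae_withDensity_iff hm]
  have h0 : ∀ᵐ x ∂(volume : Measure ℝ), x ≠ 0 := by
    simp [ae_iff]
  filter_upwards [h0] with x hx hne
  by_contra hlt
  exact hne (gammaPDF_of_neg (lt_of_le_of_ne (not_lt.1 hlt) hx))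

lemma aux_tangent (L : ℝ → ℝ) (hd : Differentiable ℝ L) (hc : ConvexOn ℝ Set.univ L) (x y : ℝ) :
    L x + deriv L x * (y - x) ≤ L y := by
  rcases lt_trichotomy x y with h | h | h
  · have := hc.deriv_le_slope (Set.mem_univ x) (Set.mem_univ y) h (hd x)
    rw [slope_def_field, le_div_iff₀ (by linarith)] at this
    linarith
  · subst h; simp
  · have := hc.slope_le_deriv (Set.mem_univ y) (Set.mem_univ x) h (hd x)
    rw [slope_def_field, div_le_iff₀ (by linarith)] at this
    linarith

/-- For `U₁ ~ Exp(rate n₁)` and `V₁ ~ Gamma(n₁ - 1, 1)` independent and a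
twice differentiable, strictly convex loss `L` minimized at `0` (with all relevant
expectations finite), there is a unique `c₀₁` with `E[L'(U₁ - c₀₁ V₁) V₁] = 0`;
moreover `c₀₁ > 0` and `c ↦ E[L(U₁ - c V₁)]` is minimized at `c₀₁`. -/
theorem stmt_2 (n₁ : ℕ) (hn₁ : 2 ≤ n₁)
    (L : ℝ → ℝ) (hL : ContDiff ℝ 2 L) (hLconv : StrictConvexOn ℝ Set.univ L)
    (hLmin : ∀ t : ℝ, L 0 ≤ L t)
    (ν : Measure (ℝ × ℝ))
    (hν : ν = (expMeasure n₁).prod (gammaMeasure ((n₁ : ℝ) - 1) 1))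
    (hint : ∀ c : ℝ, Integrable (fun p : ℝ × ℝ => deriv L (p.1 - c * p.2) * p.2) ν)
    (hint' : ∀ c : ℝ, Integrable (fun p : ℝ × ℝ => L (p.1 - c * p.2)) ν) :
    ∃ c₀₁ : ℝ, (∫ p : ℝ × ℝ, deriv L (p.1 - c₀₁ * p.2) * p.2 ∂ν) = 0 ∧
      (∀ c : ℝ, (∫ p : ℝ × ℝ, deriv L (p.1 - c * p.2) * p.2 ∂ν) = 0 → c = c₀₁) ∧
      0 < c₀₁ ∧
      (∀ c : ℝ, (∫ p : ℝ × ℝ, L (p.1 - c₀₁ * p.2) ∂ν) ≤ ∫ p : ℝ × ℝ, L (p.1 - c * p.2) ∂ν) := by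
  have hn : (2 : ℝ) ≤ n₁ := by exact_mod_cast hn₁
  have hP1 : IsProbabilityMeasure (expMeasure (n₁ : ℝ)) :=
    isProbabilityMeasure_expMeasure (by linarith)
  have hP2 : IsProbabilityMeasure (gammaMeasure ((n₁ : ℝ) - 1) 1) :=
    isProbabilityMeasure_gammaMeasure (by linarith) one_pos
  have hP : IsProbabilityMeasure ν := by rw [hν]; infer_instance
  have hU : ∀ᵐ p ∂ν, 0 < p.1 := by
    rw [hν]; exact Measure.quasiMeasurePreserving_fst.ae (aux_gamma_pos 1 n₁)
  have hV : ∀ᵐ p ∂ν, 0 < p.2 := by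
    rw [hν]; exact Measure.quasiMeasurePreserving_snd.ae (aux_gamma_pos _ 1)
  clear hν
  have hd : Differentiable ℝ L := hL.differentiable (by norm_num)
  have hdc : Continuous (deriv L) := hL.continuous_deriv (by norm_num)
  have hmono : StrictMono (deriv L) := by
    have := hLconv.strictMonoOn_deriv (fun x _ => hd x)
    exact fun x y h => this (Set.mem_univ x) (Set.mem_univ y) h
  have hd0 : deriv L 0 = 0 :=
    IsLocalMin.deriv_eq_zero (Filter.Eventually.of_forall hLmin)
  set G : ℝ → ℝ := fun c => ∫ p : ℝ × ℝ, deriv L (p.1 - c * p.2) * p.2 ∂ν with hG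
  have hanti : StrictAnti G := by
    intro a b hab
    have := aux_int_pos ν _ ((hint a).sub (hint b)) (by
      filter_upwards [hV] with p hp
      have h1 : deriv L (p.1 - b * p.2) < deriv L (p.1 - a * p.2) := by
        apply hmono
        nlinarith
      simp only [Pi.sub_apply]
      nlinarith)
    simp only [Pi.sub_apply] at this
    rw [integral_sub (hint a) (hint b)] at this
    simp only [hG]
    linarith
  have hG0 : 0 < G 0 := by
    apply aux_int_pos ν _ (hint 0)
    filter_upwards [hU, hV] with p hp1 hp2
    have : deriv L 0 < deriv L (p.1 - 0 * p.2) := hmono (by linarith)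
    rw [hd0] at this
    positivity
  have hcont : Continuous G := by
    rw [continuous_iff_continuousAt]
    intro c
    refine continuousAt_of_dominated (bound := fun p => |deriv L (p.1 - (c - 1) * p.2) * p.2|
        + |deriv L (p.1 - (c + 1) * p.2) * p.2|) ?_ ?_ ?_ ?_
    · exact Filter.Eventually.of_forall fun x => (hint x).aestronglyMeasurable
    · filter_upwards [Icc_mem_nhds (show c - 1 < c by linarith) (show c < c + 1 by linarith)]
        with x hx
      filter_upwards [hV] with p hp
      have h1 : deriv L (p.1 - x * p.2) * p.2 ≤ deriv L (p.1 - (c - 1) * p.2) * p.2 :=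
        mul_le_mul_of_nonneg_right (hmono.monotone (by nlinarith [hx.1])) hp.le
      have h2 : deriv L (p.1 - (c + 1) * p.2) * p.2 ≤ deriv L (p.1 - x * p.2) * p.2 :=
        mul_le_mul_of_nonneg_right (hmono.monotone (by nlinarith [hx.2])) hp.le
      rw [Real.norm_eq_abs, abs_le]
      constructor
      · linarith [neg_abs_le (deriv L (p.1 - (c + 1) * p.2) * p.2),
          abs_nonneg (deriv L (p.1 - (c - 1) * p.2) * p.2)]
      · linarith [le_abs_self (deriv L (p.1 - (c - 1) * p.2) * p.2),
          abs_nonneg (deriv L (p.1 - (c + 1) * p.2) * p.2)]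
    · exact (hint _).abs.add (hint _).abs
    · refine Filter.Eventually.of_forall fun p => ?_
      have : Continuous fun x : ℝ => deriv L (p.1 - x * p.2) * p.2 := by fun_prop
      exact this.continuousAt
  -- G is eventually negative
  have hneg : ∃ N : ℕ, G N < 0 := by
    set k : ℝ := -deriv L (-1) with hk
    have hkpos : 0 < k := by
      have : deriv L (-1) < deriv L 0 := hmono (by norm_num)
      rw [hd0] at this; linarith
    have hmeas : Measurable fun p : ℝ × ℝ => -(k * min p.2 1) := by fun_prop
    have hbd : ∀ᵐ p ∂ν, ‖-(k * min p.2 1)‖ ≤ k := by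
      filter_upwards [hV] with p hp
      have h1 : 0 < min p.2 1 := lt_min hp one_pos
      have h2 : min p.2 1 ≤ 1 := min_le_right _ _
      rw [norm_neg, Real.norm_eq_abs, abs_of_pos (by positivity)]
      nlinarith
    have hgi : Integrable (fun p : ℝ × ℝ => -(k * min p.2 1)) ν :=
      Integrable.of_bound hmeas.aestronglyMeasurable k hbd
    have hlimneg : ∫ p : ℝ × ℝ, -(k * min p.2 1) ∂ν < 0 := by
      have := aux_int_pos ν _ hgi.neg (by
        filter_upwards [hV] with p hp
        have h1 : 0 < min p.2 1 := lt_min hp one_pos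
        simp only [Pi.neg_apply, neg_neg]
        positivity)
      simp only [Pi.neg_apply] at this
      rw [integral_neg] at this
      linarith
    have hlim : Filter.Tendsto (fun N : ℕ => ∫ p : ℝ × ℝ,
        max (deriv L (p.1 - N * p.2) * p.2) (-(k * min p.2 1)) ∂ν) Filter.atTop
        (nhds (∫ p : ℝ × ℝ, -(k * min p.2 1) ∂ν)) := by
      refine tendsto_integral_of_dominated_convergence
        (fun p => |deriv L (p.1 - 0 * p.2) * p.2| + k) ?_ ?_ ?_ ?_
      · exact fun N => ((hint N).sup hgi).aestronglyMeasurable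
      · exact (hint 0).abs.add (integrable_const k)
      · intro N
        filter_upwards [hV, hbd] with p hp hb
        have h1 : deriv L (p.1 - N * p.2) * p.2 ≤ deriv L (p.1 - 0 * p.2) * p.2 :=
          mul_le_mul_of_nonneg_right (hmono.monotone (by
            have : (0 : ℝ) ≤ N := Nat.cast_nonneg N
            nlinarith)) hp.le
        rw [Real.norm_eq_abs, abs_le] at hb
        have h3 := le_abs_self (deriv L (p.1 - 0 * p.2) * p.2)
        have h4 := abs_nonneg (deriv L (p.1 - 0 * p.2) * p.2)
        rw [Real.norm_eq_abs, abs_le]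
        constructor
        · exact le_trans (by linarith [hb.1]) (le_max_right _ _)
        · exact max_le (by linarith) (by linarith [hb.2])
      · filter_upwards [hV] with p hp
        refine tendsto_const_nhds.congr' ?_
        obtain ⟨M, hM⟩ := exists_nat_gt ((p.1 + 1) / p.2)
        filter_upwards [Filter.eventually_ge_atTop M] with N hN
        symm
        apply max_eq_right
        have hNM : (M : ℝ) ≤ N := by exact_mod_cast hN
        rw [div_lt_iff₀ hp] at hM
        have h1 : deriv L (p.1 - N * p.2) ≤ deriv L (-1) := hmono.monotone (by nlinarith)
        have h2 : min p.2 1 ≤ p.2 := min_le_left _ _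
        nlinarith
    obtain ⟨N, hN⟩ := (hlim.eventually (gt_mem_nhds hlimneg)).exists
    refine ⟨N, lt_of_le_of_lt ?_ hN⟩
    exact integral_mono (hint N) ((hint N).sup hgi) (fun p => le_max_left _ _)
  obtain ⟨N, hN⟩ := hneg
  obtain ⟨c₀, -, hc₀⟩ := intermediate_value_Icc' (Nat.cast_nonneg (α := ℝ) N)
    hcont.continuousOn ⟨hN.le, hG0.le⟩
  refine ⟨c₀, hc₀, fun c hc => hanti.injective (hc.trans hc₀.symm), ?_, ?_⟩
  · apply hanti.lt_iff_gt.1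
    rw [hc₀]; exact hG0
  · intro c
    have h1 : ∫ p : ℝ × ℝ, (L (p.1 - c₀ * p.2)
        + (c₀ - c) * (deriv L (p.1 - c₀ * p.2) * p.2)) ∂ν ≤ ∫ p : ℝ × ℝ, L (p.1 - c * p.2) ∂ν := by
      refine integral_mono ((hint' c₀).add ((hint c₀).const_mul _)) (hint' c) fun p => ?_
      have := aux_tangent L hd hLconv.convexOn (p.1 - c₀ * p.2) (p.1 - c * p.2)
      refine le_trans (le_of_eq ?_) this
      ring
    rw [integral_add (hint' c₀) ((hint c₀).const_mul _), integral_const_mul] at h1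
    have h2 : ∫ p : ℝ × ℝ, deriv L (p.1 - c₀ * p.2) * p.2 ∂ν = 0 := hc₀
    rw [h2] at h1
    linarith
end

section
/- Let n₁ ≥ 2 and n₂ ≥ 2 be integers and let 0 < a < n₁. Let U₁ and Z be independent random variables, where U₁ has the exponential distribution of rate n₁ and Z has the Gamma distribution of shape n₁+n₂-1 and scale 1. Then for b > 0, E[a(e^{a(U₁ - bZ)} - 1)] = 0 if and only if b = (1/a)((n₁/(n₁-a))^{1/(n₁+n₂-1)} - 1). -/
open MeasureTheory ProbabilityTheory Real

lemma gamma_mgf_aux {k r t : ℝ} (hk : 0 < k) (hr : 0 < r) (ht : t < r) :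
    ∫ x, Real.exp (t * x) ∂(gammaMeasure k r) = (r / (r - t)) ^ k := by
  have hs : 0 < r - t := sub_pos.2 ht
  have key : ∀ (s : ℝ) (_ : 0 < s) (g : ℝ → ℝ),
      ∫ x, g x ∂(gammaMeasure k s) = ∫ x, gammaPDFReal k s x * g x := by
    intro s hs g
    rw [gammaMeasure, integral_withDensity_eq_integral_toReal_smul]
    · refine integral_congr_ae (Filter.Eventually.of_forall fun x => ?_)
      simp [gammaPDF, ENNReal.toReal_ofReal (gammaPDFReal_nonneg hk hs x)]
    · exact (measurable_gammaPDFReal k s).ennreal_ofReal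
    · exact Filter.Eventually.of_forall fun x => by simp [gammaPDF]
  have h1 : ∫ x, gammaPDFReal k (r - t) x = 1 := by
    have := isProbabilityMeasure_gammaMeasure hk hs
    have h := key (r - t) hs (fun _ => 1)
    simpa using h.symm
  rw [key r hr]
  have h2 : ∀ x, gammaPDFReal k r x * Real.exp (t * x)
      = (r / (r - t)) ^ k * gammaPDFReal k (r - t) x := by
    intro x
    unfold gammaPDFReal
    split_ifs with hx
    · have hpos : (0 : ℝ) < (r - t) ^ k := Real.rpow_pos_of_pos hs k
      have hG := Real.Gamma_pos_of_pos hk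
      have e : Real.exp (-((r - t) * x)) = Real.exp (-(r * x)) * Real.exp (t * x) := by
        rw [← Real.exp_add]; congr 1; ring
      rw [Real.div_rpow hr.le hs.le, e]
      field_simp
    · simp
  simp_rw [h2]
  rw [integral_const_mul, h1, mul_one]

/-- For `U₁ ~ Exp(rate n₁)` and `Z ~ Gamma(n₁+n₂-1, 1)` independent and
`0 < a < n₁`, for `b > 0` one has `E[a(e^{a(U₁ - bZ)} - 1)] = 0` iff
`b = (1/a)((n₁/(n₁-a))^{1/(n₁+n₂-1)} - 1)`. -/
theorem stmt_9 (n₁ n₂ : ℕ) (hn₁ : 2 ≤ n₁) (hn₂ : 2 ≤ n₂)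
    (a : ℝ) (ha : 0 < a) (ha' : a < n₁)
    (ν : Measure (ℝ × ℝ))
    (hν : ν = (expMeasure n₁).prod (gammaMeasure ((n₁ : ℝ) + (n₂ : ℝ) - 1) 1)) :
    ∀ b : ℝ, 0 < b →
      ((∫ p : ℝ × ℝ, a * (Real.exp (a * (p.1 - b * p.2)) - 1) ∂ν) = 0 ↔
        b = (1 / a) * (((n₁ : ℝ) / ((n₁ : ℝ) - a))
          ^ ((1 : ℝ) / ((n₁ : ℝ) + (n₂ : ℝ) - 1)) - 1)) := by
  intro b hb
  have h1 : (2 : ℝ) ≤ n₁ := by exact_mod_cast hn₁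
  have h2 : (2 : ℝ) ≤ n₂ := by exact_mod_cast hn₂
  set K : ℝ := (n₁ : ℝ) + (n₂ : ℝ) - 1 with hK
  have hKpos : 0 < K := by linarith
  have hn : (0 : ℝ) < n₁ := by linarith
  have hd : (0 : ℝ) < n₁ - a := by linarith
  have hc : 0 < (n₁ : ℝ) / (n₁ - a) := div_pos hn hd
  have hab : 0 < 1 + a * b := by positivity
  have := isProbabilityMeasure_expMeasure hn
  have := isProbabilityMeasure_gammaMeasure hKpos one_pos
  have hprob : IsProbabilityMeasure ν := by rw [hν]; infer_instance
  have hE : ∫ p : ℝ × ℝ, Real.exp (a * (p.1 - b * p.2)) ∂ν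
      = (n₁ : ℝ) / (n₁ - a) * ((1 + a * b) ^ K)⁻¹ := by
    have e : ∀ p : ℝ × ℝ, Real.exp (a * (p.1 - b * p.2))
        = Real.exp (a * p.1) * Real.exp (-(a * b) * p.2) := by
      intro p
      rw [← Real.exp_add]; congr 1; ring
    simp_rw [e]
    rw [hν, integral_prod_mul (fun x => Real.exp (a * x)) (fun x => Real.exp (-(a * b) * x)),
      expMeasure, gamma_mgf_aux one_pos hn ha',
      gamma_mgf_aux hKpos one_pos (by nlinarith [mul_pos ha hb]), Real.rpow_one,
      sub_neg_eq_add, one_div, Real.inv_rpow hab.le]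
  have hpos : (0 : ℝ) < (1 + a * b) ^ K := Real.rpow_pos_of_pos hab K
  have hint : Integrable (fun p : ℝ × ℝ => Real.exp (a * (p.1 - b * p.2))) ν := by
    by_contra hni
    rw [integral_undef hni] at hE
    exact absurd hE.symm (by positivity)
  rw [integral_const_mul, integral_sub hint (integrable_const _), hE]
  simp only [integral_const, probReal_univ, smul_eq_mul, mul_one]
  rw [mul_eq_zero, or_iff_right ha.ne', sub_eq_zero, mul_inv_eq_one₀ hpos.ne', one_div K]
  have hq := Real.eq_rpow_inv hab.le hc.le hKpos.ne'
  rw [eq_comm, ← hq]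
  constructor
  · intro h
    rw [← h]; field_simp; ring
  · intro h
    rw [h]; field_simp; ring
end

section
/- Let n₁ ≥ 2, n₂ ≥ 2 be integers, let σ₁, σ₂ > 0 and set η = σ₁/σ₂. Let T₁ and T₂ be independent random variables with Gamma distributions of shapes n₁-1 and n₂-1 and scales σ₁ and σ₂ respectively. Then the random vector (T₁/σ₁, T₂/T₁) has joint Lebesgue density g_η(v, w) = η^{n₂-1} e^{-v(1+ηw)} w^{n₂-2} v^{n₁+n₂-3} / (Γ(n₁-1)Γ(n₂-1)) for v > 0, w > 0 (and 0 otherwise). In particular, the conditional distribution of T₁/σ₁ given T₂/T₁ = w is Gamma with shape n₁+n₂-2 and rate 1+ηw. -/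
open MeasureTheory ProbabilityTheory Real

lemma aux_scale (c : ℝ) (hc : 0 < c) (f : ℝ → ENNReal) (hf : Measurable f) :
    ∫⁻ y, f y = ENNReal.ofReal c * ∫⁻ y, f (c * y) := by
  conv_lhs => rw [← Real.smul_map_volume_mul_left hc.ne']
  rw [lintegral_smul_measure, lintegral_map hf (by fun_prop), abs_of_pos hc, smul_eq_mul]

lemma aux_gammaPDF_meas (a r : ℝ) : Measurable (gammaPDF a r) :=
  (measurable_gammaPDFReal a r).ennreal_ofReal

lemma aux_map (a b r s σ : ℝ) (hσ : 0 < σ) (G : ℝ × ℝ → ENNReal)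
    (h0 : ∀ v w, v < 0 → G (v, w) = 0)
    (hG : ∀ v w, 0 < v → w ≠ 0 →
      ENNReal.ofReal σ * (gammaPDF a r (σ * v) * (ENNReal.ofReal (σ * v) *
        gammaPDF b s (σ * v * w))) = G (v, w)) (hGm : Measurable G)
    [SFinite (gammaMeasure b s)] :
    Measure.map (fun p : ℝ × ℝ => (p.1 / σ, p.2 / p.1))
        ((gammaMeasure a r).prod (gammaMeasure b s))
      = (volume : Measure (ℝ × ℝ)).withDensity G := by
  have m1 := aux_gammaPDF_meas a r
  have m2 := aux_gammaPDF_meas b s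
  have hT : Measurable (fun p : ℝ × ℝ => (p.1 / σ, p.2 / p.1)) := by fun_prop
  refine Measure.ext_of_lintegral _ fun F hF => ?_
  rw [lintegral_map hF hT, lintegral_withDensity_eq_lintegral_mul _ hGm hF]
  unfold gammaMeasure
  rw [prod_withDensity m1 m2, lintegral_withDensity_eq_lintegral_mul _ (by fun_prop) (by fun_prop),
    Measure.volume_eq_prod, lintegral_prod _ (by fun_prop), lintegral_prod _ (by fun_prop)]
  simp only [Pi.mul_apply]
  rw [aux_scale σ hσ _ (Measurable.lintegral_prod_right' (f := fun p : ℝ × ℝ =>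
    gammaPDF a r p.1 * gammaPDF b s p.2 * F (p.1 / σ, p.2 / p.1)) (by fun_prop)),
    ← lintegral_const_mul' _ _ ENNReal.ofReal_ne_top]
  refine lintegral_congr_ae ?_
  filter_upwards [Measure.ae_ne volume (0 : ℝ)] with v hv
  rcases lt_or_gt_of_ne hv with hv | hv
  · have : σ * v < 0 := mul_neg_of_pos_of_neg hσ hv
    simp [gammaPDF_of_neg this, h0 v _ hv]
  · have hx : 0 < σ * v := mul_pos hσ hv
    rw [aux_scale (σ * v) hx _ (by fun_prop), ← lintegral_const_mul' _ _ ENNReal.ofReal_ne_top,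
      ← lintegral_const_mul' _ _ ENNReal.ofReal_ne_top]
    refine lintegral_congr_ae ?_
    filter_upwards [Measure.ae_ne volume (0 : ℝ)] with w hw
    rw [← hG v w hv hw, mul_div_cancel_left₀ _ hσ.ne', mul_div_cancel_left₀ _ hx.ne']
    ring

/-- For independent `T₁ ~ Gamma(n₁-1, scale σ₁)` and
`T₂ ~ Gamma(n₂-1, scale σ₂)`, the vector `(T₁/σ₁, T₂/T₁)` has joint Lebesgue
density `g_η(v,w) = η^{n₂-1} e^{-v(1+ηw)} w^{n₂-2} v^{n₁+n₂-3}/(Γ(n₁-1)Γ(n₂-1))`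
on `(0,∞)²`, where `η = σ₁/σ₂`; in particular the conditional distribution of
`T₁/σ₁` given `T₂/T₁ = w` is `Gamma(n₁+n₂-2, rate 1+ηw)`. -/
theorem stmt_11 (n₁ n₂ : ℕ) (hn₁ : 2 ≤ n₁) (hn₂ : 2 ≤ n₂)
    (σ₁ σ₂ : ℝ) (hσ₁ : 0 < σ₁) (hσ₂ : 0 < σ₂) (η : ℝ) (hη : η = σ₁ / σ₂)
    (g : ℝ → ℝ → ℝ)
    (hg : ∀ v w : ℝ, g v w = if 0 < v ∧ 0 < w then
        η ^ (n₂ - 1) * Real.exp (-(v * (1 + η * w))) * w ^ (n₂ - 2) * v ^ (n₁ + n₂ - 3) /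
          (Real.Gamma ((n₁ : ℝ) - 1) * Real.Gamma ((n₂ : ℝ) - 1))
      else 0) :
    (Measure.map (fun p : ℝ × ℝ => (p.1 / σ₁, p.2 / p.1))
        ((gammaMeasure ((n₁ : ℝ) - 1) (1 / σ₁)).prod (gammaMeasure ((n₂ : ℝ) - 1) (1 / σ₂)))
      = (volume : Measure (ℝ × ℝ)).withDensity (fun q => ENNReal.ofReal (g q.1 q.2))) ∧
    (∀ w : ℝ, 0 < w → ∀ v : ℝ,
      g v w = (∫ v' in Set.Ioi (0 : ℝ), g v' w) *
        gammaPDFReal ((n₁ : ℝ) + (n₂ : ℝ) - 2) (1 + η * w) v) := by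
  obtain ⟨k, rfl⟩ : ∃ k, n₁ = k + 2 := ⟨n₁ - 2, by omega⟩
  obtain ⟨l, rfl⟩ : ∃ l, n₂ = l + 2 := ⟨n₂ - 2, by omega⟩
  have e1 : ((k + 2 : ℕ) : ℝ) - 1 = (k + 1 : ℕ) := by push_cast; ring
  have e2 : ((l + 2 : ℕ) : ℝ) - 1 = (l + 1 : ℕ) := by push_cast; ring
  have e3 : ((k + 2 : ℕ) : ℝ) + ((l + 2 : ℕ) : ℝ) - 2 = (k + l + 2 : ℕ) := by push_cast; ring
  have e4 : l + 2 - 1 = l + 1 := by omega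
  have e5 : l + 2 - 2 = l := by omega
  have e6 : k + 2 + (l + 2) - 3 = k + l + 1 := by omega
  rw [e1, e2, e4, e5, e6] at hg
  rw [e1, e2, e3]
  have hη0 : 0 < η := hη ▸ div_pos hσ₁ hσ₂
  have hΓ1 : 0 < Real.Gamma ((k + 1 : ℕ) : ℝ) := Real.Gamma_pos_of_pos (by positivity)
  have hΓ2 : 0 < Real.Gamma ((l + 1 : ℕ) : ℝ) := Real.Gamma_pos_of_pos (by positivity)
  have pdf : ∀ (m : ℕ) (r x : ℝ), 0 ≤ x → gammaPDFReal ((m + 1 : ℕ) : ℝ) r x =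
      r ^ (m + 1) / Real.Gamma ((m + 1 : ℕ) : ℝ) * x ^ m * Real.exp (-(r * x)) := by
    intro m r x hx
    have : ((m + 1 : ℕ) : ℝ) - 1 = m := by push_cast; ring
    rw [gammaPDFReal, if_pos hx, this, Real.rpow_natCast, Real.rpow_natCast]
  constructor
  · haveI := isProbabilityMeasure_gammaMeasure (a := ((l + 1 : ℕ) : ℝ)) (r := 1 / σ₂)
      (by positivity) (by positivity)
    refine aux_map _ _ _ _ σ₁ hσ₁ _ ?_ ?_ ?_
    · intro v w hv
      simp [hg, not_lt.mpr hv.le]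
    · intro v w hv hw
      have hx : 0 < σ₁ * v := mul_pos hσ₁ hv
      rcases lt_or_gt_of_ne hw with hw | hw
      · rw [gammaPDF_of_neg (mul_neg_of_pos_of_neg hx hw)]
        simp [hg, not_lt.mpr hw.le]
      · have hy : 0 < σ₁ * v * w := mul_pos hx hw
        have p1 : 0 ≤ gammaPDFReal ((k + 1 : ℕ) : ℝ) (1 / σ₁) (σ₁ * v) :=
          gammaPDFReal_nonneg (by positivity) (by positivity) _
        unfold gammaPDF
        rw [← ENNReal.ofReal_mul hx.le, ← ENNReal.ofReal_mul p1, ← ENNReal.ofReal_mul hσ₁.le]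
        congr 1
        simp only [hg]
        rw [if_pos ⟨hv, hw⟩, pdf _ _ _ hx.le, pdf _ _ _ hy.le]
        have hE : Real.exp (-(v * (1 + η * w))) =
            Real.exp (-(1 / σ₁ * (σ₁ * v))) * Real.exp (-(1 / σ₂ * (σ₁ * v * w))) := by
          rw [← Real.exp_add, hη]
          congr 1
          field_simp
          ring
        rw [hE, hη]
        generalize Real.exp (-(1 / σ₁ * (σ₁ * v))) = E1
        generalize Real.exp (-(1 / σ₂ * (σ₁ * v * w))) = E2
        generalize Real.Gamma ((k + 1 : ℕ) : ℝ) = G1 at *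
        generalize Real.Gamma ((l + 1 : ℕ) : ℝ) = G2 at *
        simp only [div_pow, one_pow, mul_pow]
        field_simp
        try ring
    · simp only [hg]
      refine (Measurable.ite ?_ (by fun_prop) measurable_const).ennreal_ofReal
      exact (measurableSet_lt measurable_const measurable_fst).inter
        (measurableSet_lt measurable_const measurable_snd)
  · intro w hw v
    have hr : 0 < 1 + η * w := by positivity
    have hΓ3 : 0 < Real.Gamma ((k + l + 1 + 1 : ℕ) : ℝ) := Real.Gamma_pos_of_pos (by positivity)
    have hI : ∫ v' in Set.Ioi (0 : ℝ), g v' w =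
        η ^ (l + 1) * w ^ l / (Real.Gamma ((k + 1 : ℕ) : ℝ) * Real.Gamma ((l + 1 : ℕ) : ℝ)) *
          ((1 / (1 + η * w)) ^ (k + l + 1 + 1) * Real.Gamma ((k + l + 1 + 1 : ℕ) : ℝ)) := by
      rw [← Real.rpow_natCast (1 / (1 + η * w)),
        ← Real.integral_rpow_mul_exp_neg_mul_Ioi (by positivity) hr, ← integral_const_mul]
      refine setIntegral_congr_fun measurableSet_Ioi fun x hx => ?_
      have hx' : 0 < x := hx
      have : ((k + l + 1 + 1 : ℕ) : ℝ) - 1 = (k + l + 1 : ℕ) := by push_cast; ring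
      simp only [hg]
      rw [if_pos ⟨hx', hw⟩, this, Real.rpow_natCast, mul_comm x (1 + η * w)]
      ring
    rw [hI]
    rcases lt_or_ge 0 v with hv | hv
    · rw [pdf _ _ _ hv.le, hg, if_pos ⟨hv, hw⟩, mul_comm v (1 + η * w)]
      generalize Real.exp (-((1 + η * w) * v)) = E1
      generalize Real.Gamma ((k + 1 : ℕ) : ℝ) = G1 at *
      generalize Real.Gamma ((l + 1 : ℕ) : ℝ) = G2 at *
      generalize Real.Gamma ((k + l + 1 + 1 : ℕ) : ℝ) = G3 at *
      generalize 1 + η * w = r at *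
      simp only [div_pow, one_pow]
      field_simp
    · rw [hg, if_neg (fun h => absurd h.1 (not_lt.mpr hv))]
      rcases hv.lt_or_eq with hv | rfl
      · rw [gammaPDFReal, if_neg (not_le.mpr hv), mul_zero]
      · rw [pdf _ _ _ le_rfl]
        simp
end

section
/- Let n₁ ≥ 2, n₂ ≥ 2 be integers, let w > 0 and 0 < η ≤ 1, and define g(x) = n₁(n₁+n₂-2)(1+ηw)^{n₁+n₂-2}(n₁x + 1 + ηw)^{-(n₁+n₂-1)} for x > 0 (and 0 otherwise). Then g is a probability density on ℝ, and ∫₀^m g(x) dx = 1/2 for m = (1/n₁)(2^{1/(n₁+n₂-2)} - 1)(1+ηw); that is, m is the median of the distribution with density g. -/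
open MeasureTheory ProbabilityTheory Real

/-- The function
`g(x) = n₁(n₁+n₂-2)(1+ηw)^{n₁+n₂-2}(n₁x+1+ηw)^{-(n₁+n₂-1)}` for `x > 0` is a
probability density on `ℝ`, and its median is
`m = (1/n₁)(2^{1/(n₁+n₂-2)} - 1)(1+ηw)`. -/
theorem stmt_16 (n₁ n₂ : ℕ) (hn₁ : 2 ≤ n₁) (hn₂ : 2 ≤ n₂)
    (w η : ℝ) (hw : 0 < w) (hη : 0 < η) (hη' : η ≤ 1)
    (g : ℝ → ℝ)
    (hg : ∀ x : ℝ, g x = if 0 < x then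
        (n₁ : ℝ) * ((n₁ : ℝ) + (n₂ : ℝ) - 2) * (1 + η * w) ^ ((n₁ : ℝ) + (n₂ : ℝ) - 2)
          * ((n₁ : ℝ) * x + 1 + η * w) ^ (-((n₁ : ℝ) + (n₂ : ℝ) - 1))
      else 0)
    (m : ℝ)
    (hm : m = (1 / (n₁ : ℝ)) * ((2 : ℝ) ^ (1 / ((n₁ : ℝ) + (n₂ : ℝ) - 2)) - 1) * (1 + η * w)) :
    (∀ x : ℝ, 0 ≤ g x) ∧ (∫ x : ℝ, g x) = 1 ∧ (∫ x in (0 : ℝ)..m, g x) = 1 / 2 := by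
  have h1 : (2 : ℝ) ≤ n₁ := by exact_mod_cast hn₁
  have h2 : (2 : ℝ) ≤ n₂ := by exact_mod_cast hn₂
  obtain ⟨k, hk⟩ : ∃ k : ℝ, k = (n₁ : ℝ) + (n₂ : ℝ) - 2 := ⟨_, rfl⟩
  obtain ⟨c, hc⟩ : ∃ c : ℝ, c = 1 + η * w := ⟨_, rfl⟩
  have hk0 : 0 < k := by linarith
  have hc0 : 0 < c := by rw [hc]; positivity
  have hn0 : (0 : ℝ) < n₁ := by linarith
  obtain ⟨f, hf⟩ : ∃ f : ℝ → ℝ, ∀ x, f x = (n₁ : ℝ) * k * c ^ k * ((n₁ : ℝ) * x + c) ^ (-(k + 1)) :=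
    ⟨_, fun _ => rfl⟩
  have hgf : ∀ x, g x = if 0 < x then f x else 0 := by
    intro x
    rw [hg, hf, hk, hc]
    congr 3
    · ring
    · ring
  have hpos : ∀ x : ℝ, 0 ≤ x → 0 < (n₁ : ℝ) * x + c := fun x hx => by positivity
  have hf0 : ∀ x : ℝ, 0 ≤ x → 0 ≤ f x := by
    intro x hx
    rw [hf]
    have := hpos x hx
    positivity
  obtain ⟨F, hF⟩ : ∃ F : ℝ → ℝ, F = fun x => -(c ^ k) * ((n₁ : ℝ) * x + c) ^ (-k) := ⟨_, rfl⟩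
  have hFd : ∀ x : ℝ, 0 ≤ x → HasDerivAt F (f x) x := by
    intro x hx
    have hp := hpos x hx
    have ha : HasDerivAt (fun x : ℝ => (n₁ : ℝ) * x + c) ((n₁ : ℝ) * 1) x :=
      ((hasDerivAt_id x).const_mul _).add_const c
    have hb := (ha.rpow_const (p := -k) (Or.inl hp.ne')).const_mul (-(c ^ k))
    rw [hF, hf]
    refine hb.congr_deriv ?_
    rw [show -(k + 1) = -k - 1 by ring]
    ring
  have hcc : c ^ k * c ^ (-k) = 1 := by
    rw [← Real.rpow_add hc0]; simp
  have hF0 : F 0 = -1 := by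
    rw [hF]
    simp only [mul_zero, zero_add]
    linarith
  refine ⟨?_, ?_, ?_⟩
  · intro x
    rw [hgf]
    split_ifs with h
    · exact hf0 x h.le
    · exact le_rfl
  · have hgi : g = (Set.Ioi (0 : ℝ)).indicator f := by
      ext x
      rw [hgf, Set.indicator_apply]
      rfl
    rw [hgi, integral_indicator measurableSet_Ioi]
    have ht : Filter.Tendsto F Filter.atTop (nhds 0) := by
      have ha : Filter.Tendsto (fun x : ℝ => (n₁ : ℝ) * x + c) Filter.atTop Filter.atTop :=
        Filter.tendsto_atTop_add_const_right _ _ (Filter.tendsto_id.const_mul_atTop hn0)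
      have hb := ((tendsto_rpow_neg_atTop hk0).comp ha).const_mul (-(c ^ k))
      rw [mul_zero] at hb
      rw [hF]
      exact hb
    rw [integral_Ioi_of_hasDerivAt_of_nonneg' (fun x hx => hFd x hx)
      (fun x hx => hf0 x (le_of_lt hx)) ht, hF0]
    norm_num
  · rw [← hk, ← hc] at hm
    have h2k : (1 : ℝ) ≤ (2 : ℝ) ^ (1 / k) := Real.one_le_rpow (by norm_num) (by positivity)
    have hm0 : 0 ≤ m := by
      rw [hm]
      have : (0 : ℝ) ≤ (2 : ℝ) ^ (1 / k) - 1 := by linarith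
      positivity
    have hgi : (∫ x in (0 : ℝ)..m, g x) = ∫ x in (0 : ℝ)..m, f x := by
      rw [intervalIntegral.integral_of_le hm0, intervalIntegral.integral_of_le hm0]
      refine setIntegral_congr_fun measurableSet_Ioc fun x hx => ?_
      simp only [hgf, if_pos hx.1]
    have hcont : ContinuousOn f (Set.uIcc 0 m) := by
      rw [Set.uIcc_of_le hm0]
      have hff : f = fun x => (n₁ : ℝ) * k * c ^ k * ((n₁ : ℝ) * x + c) ^ (-(k + 1)) := funext hf
      rw [hff]
      refine ContinuousOn.mul continuousOn_const (ContinuousOn.rpow_const (by fun_prop) ?_)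
      intro x hx
      exact Or.inl (hpos x hx.1).ne'
    rw [hgi, intervalIntegral.integral_eq_sub_of_hasDerivAt (f := F)
      (fun x hx => hFd x (by rw [Set.uIcc_of_le hm0] at hx; exact hx.1))
      hcont.intervalIntegrable, hF0]
    have hmc : (n₁ : ℝ) * m + c = (2 : ℝ) ^ (1 / k) * c := by
      rw [hm]; field_simp; ring
    have hFm : F m = -(1 / 2) := by
      rw [hF]
      simp only [hmc]
      rw [Real.mul_rpow (by positivity) hc0.le, ← Real.rpow_mul (by norm_num),
        show 1 / k * -k = -1 by field_simp, Real.rpow_neg_one]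
      linear_combination (-(1 / 2 : ℝ)) * hcc
    rw [hFm]
    norm_num
end
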